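/- arXiv:2211.15523 — 3 statements merged into one kernel-verified Lean document; each statement's English description precedes it below -/
import Mathlib

section
/- Let E and D be categories with zero morphisms in which countable (ℕ-indexed) products and coproducts exist, and let o be an object of E. For any object x, write can_x : ⊕_{n∈ℕ} x → ∏_{n∈ℕ} x for the canonical morphism whose (i,j)-component is the identity of x when i = j and the zero morphism when i ≠ j, and write Δ_x : x → ∏_{n∈ℕ} x for the diagonal morphism (all of whose components are the identity of x). Suppose that the diagonal Δ_o : o → ∏_{n∈ℕ} o factors through can_o, i.e., there exists a morphism s : o → ⊕_{n∈ℕ} o with can_o ∘ s = Δ_o. Then for any functor F : E → D that preserves countable coproducts and zero morphisms, the diagonal Δ_{F(o)} : F(o) → ∏_{n∈ℕ} F(o) factors through the canonical morphism can_{F(o)} : ⊕_{n∈ℕ} F(o) → ∏_{n∈ℕ} F(o). -/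
open CategoryTheory CategoryTheory.Limits

/-- The canonical morphism from the countable coproduct of copies of `x` to the countable
product of copies of `x`, whose `(i, j)`-component is the identity if `i = j` and zero
otherwise. -/
noncomputable def canonicalMap {C : Type*} [Category C] [HasZeroMorphisms C]
    [HasColimitsOfShape (Discrete ℕ) C] [HasLimitsOfShape (Discrete ℕ) C] (x : C) :
    (∐ fun _ : ℕ => x) ⟶ ∏ᶜ fun _ : ℕ => x :=
  Sigma.desc fun i => Pi.lift fun j => if i = j then 𝟙 x else 0

/-- The diagonal morphism from `x` to the countable product of copies of `x`, all of whose
components are the identity of `x`. -/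
noncomputable def diagonalMap {C : Type*} [Category C] [HasZeroMorphisms C]
    [HasLimitsOfShape (Discrete ℕ) C] (x : C) :
    x ⟶ ∏ᶜ fun _ : ℕ => x :=
  Pi.lift fun _ => 𝟙 x

/-- If the diagonal of `o` factors through the canonical map `⊕_ℕ o ⟶ ∏_ℕ o`, then for any
functor `F` preserving countable coproducts and zero morphisms, the diagonal of `F(o)`
factors through the canonical map `⊕_ℕ F(o) ⟶ ∏_ℕ F(o)`. -/
theorem diagonal_factorization_preserved
    {E : Type*} {D : Type*} [Category E] [Category D]
    [HasZeroMorphisms E] [HasZeroMorphisms D]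
    [HasColimitsOfShape (Discrete ℕ) E] [HasLimitsOfShape (Discrete ℕ) E]
    [HasColimitsOfShape (Discrete ℕ) D] [HasLimitsOfShape (Discrete ℕ) D]
    (o : E) (s : o ⟶ ∐ fun _ : ℕ => o) (hs : s ≫ canonicalMap o = diagonalMap o)
    (F : E ⥤ D) [PreservesColimitsOfShape (Discrete ℕ) F] [F.PreservesZeroMorphisms] :
    ∃ t : F.obj o ⟶ ∐ fun _ : ℕ => F.obj o,
      t ≫ canonicalMap (F.obj o) = diagonalMap (F.obj o) := by
  have key : ∀ j : ℕ, canonicalMap (F.obj o) ≫ Pi.π (fun _ : ℕ => F.obj o) j =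
      sigmaComparison F (fun _ : ℕ => o) ≫
        F.map (canonicalMap o ≫ Pi.π (fun _ : ℕ => o) j) := by
    intro j
    apply Sigma.hom_ext
    intro i
    rw [ι_comp_sigmaComparison_assoc, ← F.map_comp]
    simp only [canonicalMap, colimit.ι_desc_assoc, Cofan.mk_ι_app, limit.lift_π, Fan.mk_π_app,
      Sigma.ι_desc_assoc]
    split_ifs <;> simp
  refine ⟨F.map s ≫ inv (sigmaComparison F (fun _ : ℕ => o)), ?_⟩
  apply Pi.hom_ext
  intro j
  rw [Category.assoc, Category.assoc, key j, IsIso.inv_hom_id_assoc, ← F.map_comp,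
    ← Category.assoc, hs]
  simp [diagonalMap]
end

section
/- Let D be a category with zero morphisms in which countable (ℕ-indexed) products and coproducts exist, and let M be an object of D such that the diagonal Δ_M : M → ∏_{n∈ℕ} M factors through the canonical morphism can_M : ⊕_{n∈ℕ} M → ∏_{n∈ℕ} M. Let K be an object of D with the following compactness property with respect to M: every morphism K → ⊕_{n∈ℕ} M factors through the canonical inclusion ⊕_{n≤N} M → ⊕_{n∈ℕ} M of some finite subcoproduct. Then every morphism K → M is the zero morphism. -/
open CategoryTheory CategoryTheory.Limits

/-- The canonical inclusion of the finite subcoproduct `⊕_{n ≤ N} x` into the countable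
coproduct `⊕_{n ∈ ℕ} x`. -/
noncomputable def finiteSubcoproductIncl {C : Type*} [Category C]
    [HasColimitsOfShape (Discrete ℕ) C] [HasFiniteCoproducts C] (x : C) (N : ℕ) :
    (∐ fun _ : Fin (N + 1) => x) ⟶ ∐ fun _ : ℕ => x :=
  Sigma.desc fun i => Sigma.ι (fun _ : ℕ => x) i.val

/-- Phantom object criterion: if the diagonal of `M` factors through the canonical map
`⊕_ℕ M ⟶ ∏_ℕ M`, and `K` is such that every morphism `K ⟶ ⊕_ℕ M` factors through a finite
subcoproduct, then every morphism `K ⟶ M` is zero. -/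
theorem phantom_of_diagonal_factorization
    {D : Type*} [Category D] [HasZeroMorphisms D]
    [HasColimitsOfShape (Discrete ℕ) D] [HasLimitsOfShape (Discrete ℕ) D]
    [HasFiniteCoproducts D]
    (M : D) (s : M ⟶ ∐ fun _ : ℕ => M) (hs : s ≫ canonicalMap M = diagonalMap M)
    (K : D)
    (hK : ∀ f : K ⟶ ∐ fun _ : ℕ => M, ∃ (N : ℕ) (g : K ⟶ ∐ fun _ : Fin (N + 1) => M),
      g ≫ finiteSubcoproductIncl M N = f)
    (f : K ⟶ M) : f = 0 := by
  obtain ⟨N, g, hg⟩ := hK (f ≫ s)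
  have h1 : finiteSubcoproductIncl M N ≫ canonicalMap M ≫
      Pi.π (fun _ : ℕ => M) (N + 1) = 0 := by
    apply Sigma.hom_ext
    intro i
    have hi : (i : ℕ) ≠ N + 1 := by
      have := i.isLt
      omega
    simp [finiteSubcoproductIncl, canonicalMap, hi]
  have h2 : s ≫ canonicalMap M ≫ Pi.π (fun _ : ℕ => M) (N + 1) = 𝟙 M := by
    rw [← Category.assoc, hs]
    simp [diagonalMap]
  calc f = f ≫ s ≫ canonicalMap M ≫ Pi.π (fun _ : ℕ => M) (N + 1) := by
        rw [h2, Category.comp_id]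
    _ = (f ≫ s) ≫ canonicalMap M ≫ Pi.π (fun _ : ℕ => M) (N + 1) := by
        rw [Category.assoc]
    _ = 0 := by rw [← hg, Category.assoc, h1, comp_zero]
end

section
/- Let E and D be categories with zero morphisms in which countable (ℕ-indexed) products and coproducts exist, let o be an object of E such that the diagonal Δ_o : o → ∏_{n∈ℕ} o factors through the canonical morphism can_o : ⊕_{n∈ℕ} o → ∏_{n∈ℕ} o, and let F : E → D be a functor preserving countable coproducts and zero morphisms. Then for every object K of D with the property that every morphism K → ⊕_{n∈ℕ} F(o) factors through the canonical inclusion of some finite subcoproduct ⊕_{n≤N} F(o) → ⊕_{n∈ℕ} F(o), every morphism K → F(o) is the zero morphism. -/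
open CategoryTheory CategoryTheory.Limits

/-- If the diagonal of `o` factors through the canonical map `⊕_ℕ o ⟶ ∏_ℕ o` and `F`
preserves countable coproducts and zero morphisms, then `F(o)` is a phantom object: for
every `K` such that every morphism `K ⟶ ⊕_ℕ F(o)` factors through a finite subcoproduct,
every morphism `K ⟶ F(o)` is zero. -/
theorem image_is_phantom
    {E : Type*} {D : Type*} [Category E] [Category D]
    [HasZeroMorphisms E] [HasZeroMorphisms D]
    [HasColimitsOfShape (Discrete ℕ) E] [HasLimitsOfShape (Discrete ℕ) E]
    [HasColimitsOfShape (Discrete ℕ) D] [HasLimitsOfShape (Discrete ℕ) D]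
    [HasFiniteCoproducts D]
    (o : E) (s : o ⟶ ∐ fun _ : ℕ => o) (hs : s ≫ canonicalMap o = diagonalMap o)
    (F : E ⥤ D) [PreservesColimitsOfShape (Discrete ℕ) F] [F.PreservesZeroMorphisms]
    (K : D)
    (hK : ∀ f : K ⟶ ∐ fun _ : ℕ => F.obj o,
      ∃ (N : ℕ) (g : K ⟶ ∐ fun _ : Fin (N + 1) => F.obj o),
        g ≫ finiteSubcoproductIncl (F.obj o) N = f)
    (f : K ⟶ F.obj o) : f = 0 := by
  have h1 : ∀ j : ℕ, s ≫ Sigma.desc (fun i : ℕ => if i = j then 𝟙 o else 0) = 𝟙 o := by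
    intro j
    have h := congrArg (fun t => t ≫ Pi.π (fun _ : ℕ => o) j) hs
    have e : canonicalMap o ≫ Pi.π (fun _ : ℕ => o) j
        = Sigma.desc (fun i : ℕ => if i = j then 𝟙 o else 0) := by
      apply Sigma.hom_ext
      intro i
      simp [canonicalMap]
    simp only [Category.assoc, e] at h
    rw [h]
    simp [diagonalMap]
  obtain ⟨N, g, hg⟩ := hK (f ≫ F.map s ≫ inv (sigmaComparison F (fun _ : ℕ => o)))
  have h2 : finiteSubcoproductIncl (F.obj o) N ≫ sigmaComparison F (fun _ : ℕ => o) ≫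
      F.map (Sigma.desc (fun i : ℕ => if i = N + 1 then 𝟙 o else 0)) = 0 := by
    apply Sigma.hom_ext
    intro i
    have hi : (i : ℕ) ≠ N + 1 := by have := i.isLt; omega
    simp only [finiteSubcoproductIncl, colimit.ι_desc_assoc, Cofan.mk_ι_app, comp_zero]
    rw [ι_comp_sigmaComparison_assoc, ← F.map_comp]
    simp [hi]
  have h3 := congrArg (fun t => t ≫ sigmaComparison F (fun _ : ℕ => o) ≫
      F.map (Sigma.desc (fun i : ℕ => if i = N + 1 then 𝟙 o else 0))) hg
  simp only [Category.assoc, h2, comp_zero, IsIso.inv_hom_id_assoc] at h3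
  rw [← F.map_comp, h1, F.map_id, Category.comp_id] at h3
  exact h3.symm
end
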